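/- (i) For every real hyperplane H = {λ ∈ V : ⟨λ, α_H⟩ = s_H} (α_H ∈ V₀ \ {0}, s_H ∈ ℝ): if λ ∈ H then ⟨Im λ, α_H⟩ = 0 and Re λ ∈ H; hence for any subset ω ⊆ V₀ the tube ω + iV₀ meets H if and only if ω meets H. (ii) Consequently, for every bounded subset ω ⊆ V₀ only finitely many members of a locally finite collection 𝓗 of real hyperplanes meet the tube ω + iV₀, so π_{ω+iV₀} is a well-defined polynomial. (iii) For every φ ∈ 𝓜(V, 𝓗, d) and every bounded open subset ω ⊆ V₀, the function π_{ω+iV₀}·φ extends holomorphically to the entire tube ω + iV₀. -/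

import Mathlib

open Filter Topology Bornology

noncomputable section

/-- The complexification `V` of `V₀`, modelled as `EuclideanSpace ℂ (Fin n)`. -/
abbrev Vc (n : ℕ) := EuclideanSpace ℂ (Fin n)

/-- `V₀`: a finite-dimensional real inner product space, modelled as `EuclideanSpace ℝ (Fin n)`. -/
abbrev Vr (n : ℕ) := EuclideanSpace ℝ (Fin n)

/-- The real part `Re λ ∈ V₀` of `λ ∈ V`. -/
def reP (n : ℕ) (lam : Vc n) : Vr n := WithLp.toLp 2 (fun i => (lam i).re)

/-- The imaginary part `Im λ ∈ V₀` of `λ ∈ V`. -/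
def imP (n : ℕ) (lam : Vc n) : Vr n := WithLp.toLp 2 (fun i => (lam i).im)

/-- The canonical embedding `V₀ ↪ V`. -/
def embR (n : ℕ) (x : Vr n) : Vc n := WithLp.toLp 2 (fun i => (x i : ℂ))

/-- The `ℂ`-bilinear extension `⟨λ, α⟩` of the inner product of `V₀` (`α ∈ V₀`, `λ ∈ V`). -/
def pairC (n : ℕ) (lam : Vc n) (al : Vr n) : ℂ := ∑ i, lam i * (al i : ℂ)

/-- The tube `ω + iV₀ = {λ ∈ V | Re λ ∈ ω}` over a subset `ω ⊆ V₀`. -/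
def Tube (n : ℕ) (ω : Set (Vr n)) : Set (Vc n) := {lam | reP n lam ∈ ω}

/-- The real hyperplane `{λ ∈ V | ⟨λ, α⟩ = s}` determined by `α ∈ V₀ \ {0}` and `s ∈ ℝ`. -/
def RHyp (n : ℕ) (al : Vr n) (s : ℝ) : Set (Vc n) := {lam | pairC n lam al = (s : ℂ)}

/-- The polynomial `π_F(λ) = ∏_{i ∈ F} (⟨λ, α_i⟩ - s_i)^{d i}` attached to a finite set of
(indices of) hyperplanes. -/
def polyS (n : ℕ) {ι : Type*} (al : ι → Vr n) (s : ι → ℝ) (d : ι → ℕ) (F : Finset ι)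
    (lam : Vc n) : ℂ :=
  ∏ i ∈ F, (pairC n lam (al i) - (s i : ℂ)) ^ (d i)

/-- Membership in `𝓜(V, 𝓗, d)`: `φ` is holomorphic off `⋃𝓗` and for every bounded open
`U ⊆ V` the function `π_U · φ` extends holomorphically to `U`. -/
def MemM (n : ℕ) {ι : Type*} (al : ι → Vr n) (s : ι → ℝ) (d : ι → ℕ) (φ : Vc n → ℂ) :
    Prop :=
  DifferentiableOn ℂ φ (⋃ i, RHyp n (al i) (s i))ᶜ ∧
  ∀ U : Set (Vc n), IsOpen U → IsBounded U →
    ∀ hfin : {i | (RHyp n (al i) (s i) ∩ U).Nonempty}.Finite,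
    ∃ Φ : Vc n → ℂ, DifferentiableOn ℂ Φ U ∧
      ∀ lam ∈ U, lam ∉ ⋃ i, RHyp n (al i) (s i) →
        Φ lam = polyS n al s d hfin.toFinset lam * φ lam

theorem pairC_re (n : ℕ) (lam : Vc n) (al : Vr n) :
    (pairC n lam al).re = ∑ i, (lam i).re * al i := by
  simp [pairC]

theorem pairC_im (n : ℕ) (lam : Vc n) (al : Vr n) :
    (pairC n lam al).im = ∑ i, (lam i).im * al i := by
  simp [pairC]

theorem reP_embR (n : ℕ) (x : Vr n) : reP n (embR n x) = x := by
  ext i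
  simp [reP, embR]

theorem embR_reP_mem_RHyp {n : ℕ} {lam : Vc n} {al : Vr n} {s : ℝ} (h : lam ∈ RHyp n al s) :
    embR n (reP n lam) ∈ RHyp n al s := by
  have h' := congrArg Complex.re (show pairC n lam al = (s : ℂ) from h)
  rw [pairC_re, Complex.ofReal_re] at h'
  apply Complex.ext
  · rw [pairC_re, Complex.ofReal_re, ← h']
    simp [embR, reP]
  · simp [pairC_im, embR]

theorem inner_imP_eq_zero {n : ℕ} {lam : Vc n} {al : Vr n} {s : ℝ} (h : lam ∈ RHyp n al s) :
    inner ℝ (imP n lam) al = (0 : ℝ) := by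
  have h' := congrArg Complex.im (show pairC n lam al = (s : ℂ) from h)
  rw [pairC_im, Complex.ofReal_im] at h'
  simpa [PiLp.inner_apply, imP, mul_comm] using h'

theorem tube_inter_RHyp_nonempty_iff (n : ℕ) (ω : Set (Vr n)) (al : Vr n) (s : ℝ) :
    (Tube n ω ∩ RHyp n al s).Nonempty ↔ ∃ x ∈ ω, embR n x ∈ RHyp n al s := by
  constructor
  · rintro ⟨lam, h1, h2⟩
    exact ⟨_, h1, embR_reP_mem_RHyp h2⟩
  · rintro ⟨x, hx, h⟩
    exact ⟨embR n x, by simpa [Tube, reP_embR] using hx, h⟩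

theorem continuous_embR (n : ℕ) : Continuous (embR n) := by
  unfold embR
  fun_prop

theorem continuous_reP (n : ℕ) : Continuous (reP n) := by
  unfold reP
  fun_prop

theorem differentiable_pairC (n : ℕ) (al : Vr n) : Differentiable ℂ fun lam => pairC n lam al := by
  unfold pairC
  fun_prop

theorem differentiable_polyS (n : ℕ) {ι : Type*} (al : ι → Vr n) (s : ι → ℝ) (d : ι → ℕ)
    (F : Finset ι) : Differentiable ℂ (polyS n al s d F) := by
  unfold polyS
  intro lam
  classical
  refine (HasFDerivAt.finsetProd fun i _ => DifferentiableAt.hasFDerivAt ?_).differentiableAt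
  exact ((differentiable_pairC n (al i) lam).sub_const _).fun_pow _

theorem isClosed_RHyp (n : ℕ) (al : Vr n) (s : ℝ) : IsClosed (RHyp n al s) :=
  isClosed_eq (differentiable_pairC n al).continuous continuous_const

theorem pairC_add_smul (n : ℕ) (lam mu : Vc n) (c : ℂ) (al : Vr n) :
    pairC n (lam + c • mu) al = pairC n lam al + c * pairC n mu al := by
  simp [pairC, add_mul, Finset.sum_add_distrib, Finset.mul_sum, mul_assoc]

theorem pairC_embR_self_ne_zero {n : ℕ} {al : Vr n} (hal : al ≠ 0) :
    pairC n (embR n al) al ≠ 0 := by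
  have h : (pairC n (embR n al) al).re = inner ℝ al al := by
    rw [pairC_re, PiLp.inner_apply]
    simp [embR, sq]
  intro h0
  rw [h0] at h
  exact hal (inner_self_eq_zero.mp h.symm)

theorem dense_compl_RHyp {n : ℕ} {al : Vr n} (hal : al ≠ 0) (s : ℝ) :
    Dense (RHyp n al s)ᶜ := by
  intro lam
  by_cases hlam : lam ∈ RHyp n al s
  · have hc : Continuous fun c : ℂ => lam + c • embR n al := by fun_prop
    have ht : Tendsto (fun c : ℂ => lam + c • embR n al) (𝓝[≠] 0) (𝓝 lam) := by
      simpa using (hc.tendsto 0).mono_left nhdsWithin_le_nhds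
    refine mem_closure_of_tendsto ht ?_
    filter_upwards [self_mem_nhdsWithin] with c hc0 hmem
    have hmem : pairC n (lam + c • embR n al) al = s := hmem
    rw [pairC_add_smul, show pairC n lam al = s from hlam, add_eq_left] at hmem
    exact mul_ne_zero hc0 (pairC_embR_self_ne_zero hal) hmem
  · exact subset_closure hlam

theorem neBot_nhdsWithin_compl_iUnion_RHyp {n : ℕ} {ι : Type*} {al : ι → Vr n} {s : ι → ℝ}
    (hal : ∀ i, al i ≠ 0) {lam : Vc n} {U : Set (Vc n)} (hU : U ∈ 𝓝 lam)
    (hfin : {i | (RHyp n (al i) (s i) ∩ U).Nonempty}.Finite) :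
    (𝓝[(⋃ i, RHyp n (al i) (s i))ᶜ] lam).NeBot := by
  have hD : Dense (⋂ i ∈ {i | (RHyp n (al i) (s i) ∩ U).Nonempty}, (RHyp n (al i) (s i))ᶜ) :=
    dense_biInter_of_isOpen (fun i _ => (isClosed_RHyp n (al i) (s i)).isOpen_compl)
      hfin.countable fun i _ => dense_compl_RHyp (hal i) (s i)
  have hne := mem_closure_iff_nhdsWithin_neBot.mp (hD lam)
  rw [← nhdsWithin_inter_of_mem' (mem_nhdsWithin_of_mem_nhds hU)] at hne
  refine hne.mono (nhdsWithin_mono _ ?_)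
  rintro mu ⟨h1, h2⟩ hmem
  obtain ⟨i, hi⟩ := Set.mem_iUnion.mp hmem
  exact Set.mem_iInter₂.mp h1 i ⟨mu, hi, h2⟩ hi

theorem finite_setOf_RHyp_inter_of_isCompact {n : ℕ} {ι : Type*} {al : ι → Vr n} {s : ι → ℝ}
    (hloc : ∀ lam : Vc n, ∃ U ∈ 𝓝 lam, {i | (RHyp n (al i) (s i) ∩ U).Nonempty}.Finite)
    {K : Set (Vc n)} (hK : IsCompact K) :
    {i | (RHyp n (al i) (s i) ∩ K).Nonempty}.Finite := by
  refine hK.induction_on (by simp) (fun K L hKL hL => ?_) (fun K L hK hL => ?_) fun x _ => ?_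
  · exact hL.subset fun i hi => hi.mono (Set.inter_subset_inter_right _ hKL)
  · refine (hK.union hL).subset fun i hi => ?_
    simpa [Set.inter_union_distrib_left, Set.union_nonempty] using hi
  · obtain ⟨U, hU, hf⟩ := hloc x
    exact ⟨U, mem_nhdsWithin_of_mem_nhds hU, hf⟩

theorem finite_setOf_RHyp_inter_tube {n : ℕ} {ι : Type*} {al : ι → Vr n} {s : ι → ℝ}
    (hloc : ∀ lam : Vc n, ∃ U ∈ 𝓝 lam, {i | (RHyp n (al i) (s i) ∩ U).Nonempty}.Finite)
    {ω : Set (Vr n)} (hω : IsBounded ω) :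
    {i | (RHyp n (al i) (s i) ∩ Tube n ω).Nonempty}.Finite := by
  refine (finite_setOf_RHyp_inter_of_isCompact hloc
    (hω.isCompact_closure.image (continuous_embR n))).subset fun i hi => ?_
  rw [Set.mem_ofPred_eq, Set.inter_comm, tube_inter_RHyp_nonempty_iff] at hi
  obtain ⟨x, hx, hxi⟩ := hi
  exact ⟨embR n x, hxi, x, subset_closure hx, rfl⟩

theorem polyS_mul_polyS_sdiff {n : ℕ} {ι : Type*} [DecidableEq ι] (al : ι → Vr n) (s : ι → ℝ)
    (d : ι → ℕ) {F G : Finset ι} (h : F ⊆ G) (lam : Vc n) :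
    polyS n al s d (G \ F) lam * polyS n al s d F lam = polyS n al s d G lam :=
  Finset.prod_sdiff h

/-- For `φ ∈ 𝓜(V, 𝓗, d)` and an open set `T` met by only finitely many of the hyperplanes,
the function `π_T · φ` extends holomorphically to `T`, whether or not `T` is bounded. -/
theorem MemM.exists_differentiableOn_extension {n : ℕ} {ι : Type*} {al : ι → Vr n} {s : ι → ℝ}
    {d : ι → ℕ} {φ : Vc n → ℂ} (hφ : MemM n al s d φ) (hal : ∀ i, al i ≠ 0)
    {T : Set (Vc n)} (hT : IsOpen T)
    (hfin : {i | (RHyp n (al i) (s i) ∩ T).Nonempty}.Finite) :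
    ∃ Φ : Vc n → ℂ, DifferentiableOn ℂ Φ T ∧
      ∀ lam ∈ T, lam ∉ ⋃ i, RHyp n (al i) (s i) →
        Φ lam = polyS n al s d hfin.toFinset lam * φ lam := by
  classical
  have hball : ∀ R : ℝ, ∃ Ψ : Vc n → ℂ, DifferentiableOn ℂ Ψ (T ∩ Metric.ball 0 R) ∧
      ∀ lam ∈ T ∩ Metric.ball 0 R, lam ∉ ⋃ i, RHyp n (al i) (s i) →
        Ψ lam = polyS n al s d hfin.toFinset lam * φ lam := by
    intro R
    have hsub : {i | (RHyp n (al i) (s i) ∩ (T ∩ Metric.ball 0 R)).Nonempty} ⊆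
        {i | (RHyp n (al i) (s i) ∩ T).Nonempty} :=
      fun i hi => hi.mono (Set.inter_subset_inter_right _ Set.inter_subset_left)
    obtain ⟨Ψ, hd, he⟩ := hφ.2 (T ∩ Metric.ball 0 R) (hT.inter Metric.isOpen_ball)
      (Metric.isBounded_ball.subset Set.inter_subset_right) (hfin.subset hsub)
    refine ⟨fun lam => polyS n al s d (hfin.toFinset \ (hfin.subset hsub).toFinset) lam * Ψ lam,
      (differentiable_polyS n al s d _).differentiableOn.mul hd, fun lam hlam hn => ?_⟩
    dsimp only
    rw [he lam hlam hn, ← mul_assoc,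
      polyS_mul_polyS_sdiff al s d (Set.Finite.toFinset_subset_toFinset.mpr hsub)]
  choose Ψ hd he using hball
  set N : Set (Vc n) := (⋃ i, RHyp n (al i) (s i))ᶜ
  set Φ : Vc n → ℂ := fun lam =>
    limUnder (𝓝[N] lam) fun mu => polyS n al s d hfin.toFinset mu * φ mu
  have hopen : ∀ R : ℝ, IsOpen (T ∩ Metric.ball 0 R) := fun R => hT.inter Metric.isOpen_ball
  have key : ∀ R : ℝ, ∀ lam ∈ T ∩ Metric.ball 0 R, Φ lam = Ψ R lam := by
    intro R lam hlam
    have hne : (𝓝[N] lam).NeBot :=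
      neBot_nhdsWithin_compl_iUnion_RHyp hal (hT.mem_nhds hlam.1) hfin
    have hmem := (hopen R).mem_nhds hlam
    have ht : Tendsto (Ψ R) (𝓝[N] lam) (𝓝 (Ψ R lam)) :=
      ((hd R).differentiableAt hmem).continuousAt.tendsto.mono_left nhdsWithin_le_nhds
    refine (ht.congr' ?_).limUnder_eq
    filter_upwards [self_mem_nhdsWithin, mem_nhdsWithin_of_mem_nhds hmem] with mu h1 h2
    exact he R mu h2 h1
  have hin : ∀ lam ∈ T, lam ∈ T ∩ Metric.ball 0 (‖lam‖ + 1) := fun lam hlam => ⟨hlam, by simp⟩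
  refine ⟨Φ, fun lam hlam => ?_, fun lam hlam hn => ?_⟩
  · have hmem := (hopen _).mem_nhds (hin lam hlam)
    refine (((hd _).differentiableAt hmem).congr_of_eventuallyEq ?_).differentiableWithinAt
    filter_upwards [hmem] with mu hmu using key _ mu hmu
  · rw [key _ lam (hin lam hlam), he _ lam (hin lam hlam) hn]

/-- **Statement 2.**  (i) For a real hyperplane `H = {λ | ⟨λ, α⟩ = s}`: if `λ ∈ H` then
`⟨Im λ, α⟩ = 0` and `Re λ ∈ H`; hence a tube `ω + iV₀` meets `H` iff `ω` meets `H`.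
(ii) Consequently, for a bounded `ω ⊆ V₀` only finitely many members of a locally finite
collection `𝓗` of real hyperplanes meet the tube `ω + iV₀`, so `π_{ω+iV₀}` is a
well-defined polynomial.  (iii) For every `φ ∈ 𝓜(V, 𝓗, d)` and every bounded open
`ω ⊆ V₀`, the function `π_{ω+iV₀} · φ` extends holomorphically to the whole tube
`ω + iV₀`. -/
theorem tube_hyperplanes (n : ℕ) {ι : Type*} (al : ι → Vr n) (s : ι → ℝ)
    (d : ι → ℕ) (hal : ∀ i, al i ≠ 0)
    (hinj : Function.Injective fun i => RHyp n (al i) (s i))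
    (hloc : ∀ lam : Vc n, ∃ U ∈ 𝓝 lam,
      {i | (RHyp n (al i) (s i) ∩ U).Nonempty}.Finite) :
    -- (i)
    (∀ (β : Vr n), β ≠ 0 → ∀ t : ℝ,
      (∀ lam ∈ RHyp n β t, inner ℝ (imP n lam) β = (0 : ℝ) ∧ embR n (reP n lam) ∈ RHyp n β t)
      ∧ ∀ ω : Set (Vr n),
        (Tube n ω ∩ RHyp n β t).Nonempty ↔ ∃ x ∈ ω, embR n x ∈ RHyp n β t) ∧
    -- (ii)
    (∀ ω : Set (Vr n), IsBounded ω →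
      {i | (RHyp n (al i) (s i) ∩ Tube n ω).Nonempty}.Finite) ∧
    -- (iii)
    (∀ φ : Vc n → ℂ, MemM n al s d φ →
      ∀ ω : Set (Vr n), IsOpen ω → IsBounded ω →
      ∀ hfin : {i | (RHyp n (al i) (s i) ∩ Tube n ω).Nonempty}.Finite,
      ∃ Φ : Vc n → ℂ, DifferentiableOn ℂ Φ (Tube n ω) ∧
        ∀ lam ∈ Tube n ω, lam ∉ ⋃ i, RHyp n (al i) (s i) →
          Φ lam = polyS n al s d hfin.toFinset lam * φ lam) := by
  refine ⟨fun β _ t => ⟨fun lam h => ⟨inner_imP_eq_zero h, embR_reP_mem_RHyp h⟩,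
    fun ω => tube_inter_RHyp_nonempty_iff n ω β t⟩,
    fun ω hω => finite_setOf_RHyp_inter_tube hloc hω, fun φ hφ ω hω _ hfin => ?_⟩
  exact hφ.exists_differentiableOn_extension hal (hω.preimage (continuous_reP n)) hfin

end
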